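/- arXiv:1906.02436 — 2 statements merged into one kernel-verified Lean document; each statement's English description precedes it below -/
import Mathlib

section
/- Assume the primal–dual setup with β ≥ 2α, let δ > 0, 1 ≤ k ≤ n, set η = μ/(2L), set q = 5βRδk/(2αμn²), and suppose q ≤ 1. Suppose x^t ∈ C, y^{t−1} ∈ ℝ^n, and that one step of the Primal–Dual Block Frank–Wolfe method with step sizes η, δ and block size k produces x̄^t, I, y^t, x̃^t, x^{t+1}. Define Δ_d^t = D* − D(y^t), Δ_d^{t−1} = D* − D(y^{t−1}), Δ_p^t = L(x^{t+1}, y^t) − D(y^t), Δ_p^{t−1} = L(x^t, y^{t−1}) − D(y^{t−1}). Then (β/α − 1)(Δ_d^t − Δ_d^{t−1}) + Δ_p^t − Δ_p^{t−1} ≤ −(kδ/(4αn))·Δ_d^t − ((1 − q)·(μ/(4L)) − q)·Δ_p^t. -/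
open RealInnerProductSpace

/-- The descent lemma: a Lipschitz gradient gives a quadratic upper bound. -/
lemma le_quadratic_of_gradient_lipschitz {F : Type*} [NormedAddCommGroup F]
    [InnerProductSpace ℝ F] [CompleteSpace F] {f : F → ℝ} {f' : F → F} {K : ℝ}
    (hf : ∀ x, HasGradientAt f (f' x) x) (hlip : ∀ u v, ‖f' u - f' v‖ ≤ K * ‖u - v‖) (u v : F) :
    f v ≤ f u + ⟪f' u, v - u⟫ + K / 2 * ‖v - u‖ ^ 2 := by
  set p := v - u with hp
  let ψ : ℝ → ℝ := fun t => f (u + t • p) - t * ⟪f' u, p⟫ - K / 2 * ‖p‖ ^ 2 * t ^ 2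
  have hψ : ∀ t, HasDerivAt ψ (⟪f' (u + t • p), p⟫ - ⟪f' u, p⟫ - K * ‖p‖ ^ 2 * t) t := by
    intro t
    have hline : HasDerivAt (fun s : ℝ => u + s • p) p t := by
      simpa using ((hasDerivAt_id t).smul_const p).const_add u
    have hcomp : HasDerivAt (fun s : ℝ => f (u + s • p)) ⟪f' (u + t • p), p⟫ t := by
      have h := (hf (u + t • p)).hasFDerivAt.comp_hasDerivAt t hline
      rw [InnerProductSpace.toDual_apply_apply] at h
      exact h
    have hlin : HasDerivAt (fun s : ℝ => s * ⟪f' u, p⟫) ⟪f' u, p⟫ t := by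
      simpa using (hasDerivAt_id t).mul_const ⟪f' u, p⟫
    have hsq : HasDerivAt (fun s : ℝ => K / 2 * ‖p‖ ^ 2 * s ^ 2) (K * ‖p‖ ^ 2 * t) t := by
      refine ((hasDerivAt_pow 2 t).const_mul (K / 2 * ‖p‖ ^ 2)).congr_deriv ?_
      norm_num
      ring
    exact (hcomp.sub hlin).sub hsq
  have hanti : AntitoneOn ψ (Set.Icc 0 1) := by
    refine antitoneOn_of_deriv_nonpos (convex_Icc 0 1)
      (fun t _ => (hψ t).continuousAt.continuousWithinAt)
      (fun t _ => (hψ t).differentiableAt.differentiableWithinAt) ?_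
    intro t ht
    rw [interior_Icc] at ht
    rw [(hψ t).deriv, ← inner_sub_left]
    have hcs := real_inner_le_norm (f' (u + t • p) - f' u) p
    have hnorm : ‖f' (u + t • p) - f' u‖ ≤ K * (t * ‖p‖) := by
      simpa [norm_smul, abs_of_pos ht.1] using hlip (u + t • p) u
    nlinarith [mul_le_mul_of_nonneg_right hnorm (norm_nonneg p)]
  have h01 := hanti (by simp : (0 : ℝ) ∈ Set.Icc 0 1) (by simp : (1 : ℝ) ∈ Set.Icc 0 1) zero_le_one
  simp only [ψ, one_smul, zero_smul, add_zero, hp, add_sub_cancel] at h01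
  rw [← hp] at h01
  linarith

/-- First-order optimality on a convex set, from a quadratic upper bound at the minimizer. -/
lemma inner_nonneg_of_isMinOn_of_le_quadratic {E : Type*} [NormedAddCommGroup E]
    [InnerProductSpace ℝ E] {C : Set E} (hC : Convex ℝ C) {h : E → ℝ} {z G : E} {L : ℝ}
    (hz : z ∈ C) (hmin : IsMinOn h C z)
    (hsm : ∀ v, h v ≤ h z + ⟪G, v - z⟫ + L / 2 * ‖v - z‖ ^ 2) {x : E} (hx : x ∈ C) :
    0 ≤ ⟪G, x - z⟫ := by
  have hseg : ∀ s ∈ Set.Ioc (0 : ℝ) 1, 0 ≤ ⟪G, x - z⟫ + s * (L / 2 * ‖x - z‖ ^ 2) := by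
    intro s hs
    have hm := (isMinOn_iff.mp hmin) _ (hC.add_smul_sub_mem hz hx ⟨hs.1.le, hs.2⟩)
    have hq := hsm (z + s • (x - z))
    rw [add_sub_cancel_left, inner_smul_right, norm_smul, Real.norm_eq_abs, mul_pow, sq_abs] at hq
    have : 0 ≤ s * (⟪G, x - z⟫ + s * (L / 2 * ‖x - z‖ ^ 2)) := by linarith
    exact nonneg_of_mul_nonneg_right this hs.1
  have hlim : Filter.Tendsto (fun s : ℝ => ⟪G, x - z⟫ + s * (L / 2 * ‖x - z‖ ^ 2))
      (nhdsWithin 0 (Set.Ioi 0)) (nhds ⟪G, x - z⟫) := by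
    refine Filter.Tendsto.mono_left ?_ nhdsWithin_le_nhds
    have hc : Continuous (fun s : ℝ => ⟪G, x - z⟫ + s * (L / 2 * ‖x - z‖ ^ 2)) := by fun_prop
    simpa using hc.tendsto 0
  refine ge_of_tendsto hlim ?_
  filter_upwards [Ioc_mem_nhdsGT (zero_lt_one' ℝ)] with s hs using hseg s hs

/-- A `k`-subset maximizing a sum carries at least its proportional share of the total. -/
lemma card_mul_sum_le_of_forall_sum_le {ι : Type*} [Fintype ι] [DecidableEq ι] {f : ι → ℝ}
    {I : Finset ι} (hI : ∀ J : Finset ι, J.card = I.card → ∑ i ∈ J, f i ≤ ∑ i ∈ I, f i) :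
    (I.card : ℝ) * ∑ i, f i ≤ Fintype.card ι * ∑ i ∈ I, f i := by
  have hswap : ∀ i ∈ I, ∀ j ∈ Iᶜ, f j ≤ f i := by
    intro i hi j hj
    rw [Finset.mem_compl] at hj
    have hj' : j ∉ I.erase i := fun h => hj (Finset.mem_of_mem_erase h)
    have h := hI (insert j (I.erase i)) (by
      rw [Finset.card_insert_of_notMem hj', Finset.card_erase_add_one hi])
    rw [Finset.sum_insert hj', ← Finset.add_sum_erase I f hi] at h
    linarith
  have hpairs : ∑ i ∈ I, ∑ j ∈ Iᶜ, f j ≤ ∑ i ∈ I, ∑ _j ∈ Iᶜ, f i :=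
    Finset.sum_le_sum fun i hi => Finset.sum_le_sum fun j hj => hswap i hi j hj
  simp only [Finset.sum_const, nsmul_eq_mul, ← Finset.mul_sum] at hpairs
  have hsum := Finset.sum_add_sum_compl I f
  have hcard : (I.card : ℝ) + Iᶜ.card = Fintype.card ι := by
    exact_mod_cast Finset.card_add_card_compl I
  rw [← hsum, ← hcard]
  linarith

/-- The Polyak–Łojasiewicz inequality for a strongly concave function. -/
lemma sub_le_of_strongly_concave {F : Type*} [NormedAddCommGroup F] [InnerProductSpace ℝ F]
    {D : F → ℝ} {G u v : F} {β : ℝ} (hβ : 0 < β)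
    (h : -D u + ⟪-G, v - u⟫ + (1 / β) / 2 * ‖v - u‖ ^ 2 ≤ -D v) :
    D v - D u ≤ β / 2 * ‖G‖ ^ 2 := by
  rw [inner_neg_left] at h
  have hcs := real_inner_le_norm G (v - u)
  have hsq : 0 ≤ β / 2 * (‖G‖ - 1 / β * ‖v - u‖) ^ 2 := by positivity
  have hexp : β / 2 * (‖G‖ - 1 / β * ‖v - u‖) ^ 2
      = β / 2 * ‖G‖ ^ 2 - ‖G‖ * ‖v - u‖ + (1 / β) / 2 * ‖v - u‖ ^ 2 := by
    field_simp
    ring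
  linarith

/-- The pointwise estimate combining primal ascent and dual progress in one coordinate. -/
lemma dual_progress_pointwise {α β δ w e : ℝ} (hα : 0 < α) (hδ : 0 < δ) (hαβ : 2 * α ≤ β) :
    δ * w ^ 2 - β / α * (δ * ((w + e) * w)) ≤
      -(β * δ / (4 * α)) * w ^ 2 + β * δ / α * e ^ 2 := by
  obtain ⟨c, rfl⟩ : ∃ c, β = c * α := ⟨β / α, by field_simp⟩
  have hc : 2 ≤ c := le_of_mul_le_mul_right hαβ hα
  have h1 : c * α / α = c := by field_simp
  have h2 : c * α * δ / (4 * α) = c * δ / 4 := by field_simp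
  have h3 : c * α * δ / α = c * δ := by field_simp
  rw [h1, h2, h3]
  nlinarith [mul_nonneg hδ.le (mul_nonneg (sub_nonneg.2 hc) (sq_nonneg w)),
    mul_nonneg (mul_nonneg (by linarith : (0 : ℝ) ≤ c) hδ.le) (sq_nonneg (w / 2 + e))]

/-- A contraction by `1 - 2 * c` implies a contraction by `(1 + c)⁻¹`. -/
lemma one_add_mul_le_of_le_one_sub_two_mul {c p p' : ℝ} (hc : 0 ≤ c) (hp : 0 ≤ p)
    (h : p' ≤ (1 - 2 * c) * p) : (1 + c) * p' ≤ p := by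
  nlinarith [mul_le_mul_of_nonneg_left h (by linarith : 0 ≤ 1 + c),
    mul_nonneg (mul_nonneg hc hc) hp, mul_nonneg hc hp]

set_option maxHeartbeats 1000000 in
theorem stmt_11 {n d : ℕ} (a : Fin n → EuclideanSpace ℝ (Fin d)) (R : ℝ)
    (hR : ∀ i, ‖a i‖ ^ 2 ≤ R)
    (g : EuclideanSpace ℝ (Fin d) → ℝ)
    (g' : EuclideanSpace ℝ (Fin d) → EuclideanSpace ℝ (Fin d))
    (μ L : ℝ) (hμ : 0 < μ) (hμL : μ ≤ L)
    (hgdiff : ∀ x, HasGradientAt g (g' x) x)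
    (hgsc : ∀ u v, g u + ⟪g' u, v - u⟫ + μ / 2 * ‖v - u‖ ^ 2 ≤ g v)
    (hgsm : ∀ u v, g v ≤ g u + ⟪g' u, v - u⟫ + L / 2 * ‖v - u‖ ^ 2)
    (φ : EuclideanSpace ℝ (Fin n) → ℝ)
    (φ' : EuclideanSpace ℝ (Fin n) → EuclideanSpace ℝ (Fin n))
    (α : ℝ) (hα : 0 < α)
    (hφdiff : ∀ y, HasGradientAt φ (φ' y) y)
    (hφconv : ConvexOn ℝ Set.univ φ)
    (hφlip : ∀ u v, ‖φ' u - φ' v‖ ≤ (1 / α) * ‖u - v‖)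
    (Lag : EuclideanSpace ℝ (Fin d) → EuclideanSpace ℝ (Fin n) → ℝ)
    (hLag : ∀ x y, Lag x y = g x + (1 / n : ℝ) * (∑ i, y i * ⟪a i, x⟫) - φ y)
    (C : Set (EuclideanSpace ℝ (Fin d)))
    (hCne : C.Nonempty) (hCcl : IsClosed C) (hCconv : Convex ℝ C)
    (D : EuclideanSpace ℝ (Fin n) → ℝ)
    (hD : ∀ y, IsLeast ((fun x => Lag x y) '' C) (D y))
    (D' : EuclideanSpace ℝ (Fin n) → EuclideanSpace ℝ (Fin n))
    (β : ℝ) (hβ : 0 < β)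
    (hDdiff : ∀ y, HasGradientAt D (D' y) y)
    (hDsc : ∀ u v, (-D u) + ⟪-D' u, v - u⟫ + (1 / β) / 2 * ‖v - u‖ ^ 2 ≤ -D v)
    (Dstar : ℝ) (hDub : ∀ y, D y ≤ Dstar) (hDatt : ∃ y, D y = Dstar)
    -- β ≥ 2α
    (hαβ : 2 * α ≤ β)
    (δ : ℝ) (hδ : 0 < δ) (k : ℕ) (hk1 : 1 ≤ k) (hkn : k ≤ n)
    (η : ℝ) (hη : η = μ / (2 * L))
    (q : ℝ) (hqdef : q = 5 * β * R * δ * k / (2 * α * μ * n ^ 2)) (hq : q ≤ 1)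
    -- state
    (xt : EuclideanSpace ℝ (Fin d)) (hxtC : xt ∈ C)
    (yprev : EuclideanSpace ℝ (Fin n))
    -- (i) dual-optimal primal point
    (yt : EuclideanSpace ℝ (Fin n))
    (xbar : EuclideanSpace ℝ (Fin d)) (hxbarC : xbar ∈ C)
    (hxbarD : D yt = Lag xbar yt)
    (hgradD : ∀ i, D' yt i = (1 / n : ℝ) * ⟪a i, xbar⟫ - φ' yt i)
    -- (ii) greedy block dual update with w i = (1/n)⟪a i, xt⟫ - φ' yt i
    (I : Finset (Fin n)) (hI : I.card = k)
    (hgreedy : ∀ J : Finset (Fin n), J.card = k →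
        ∑ i ∈ J, ((1 / n : ℝ) * ⟪a i, xt⟫ - φ' yt i) ^ 2 ≤
          ∑ i ∈ I, ((1 / n : ℝ) * ⟪a i, xt⟫ - φ' yt i) ^ 2)
    (hin : ∀ i ∈ I, yt i = yprev i + δ * ((1 / n : ℝ) * ⟪a i, xt⟫ - φ' yt i))
    (hout : ∀ i ∉ I, yt i = yprev i)
    -- (iii) block Frank-Wolfe primal update
    (xtil : EuclideanSpace ℝ (Fin d)) (hxtilC : xtil ∈ C)
    (hfw : ⟪g' xt + (n : ℝ)⁻¹ • ∑ i, yt i • a i, xtil⟫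
          + L * η / 2 * ‖xtil - xt‖ ^ 2 ≤
        ⟪g' xt + (n : ℝ)⁻¹ • ∑ i, yt i • a i, xbar⟫
          + L * η / 2 * ‖xbar - xt‖ ^ 2)
    (xnext : EuclideanSpace ℝ (Fin d)) (hxnext : xnext = (1 - η) • xt + η • xtil) :
    (β / α - 1) * ((Dstar - D yt) - (Dstar - D yprev)) +
        ((Lag xnext yt - D yt) - (Lag xt yprev - D yprev)) ≤
      -(k * δ / (4 * α * n) : ℝ) * (Dstar - D yt) -
        ((1 - q) * (μ / (4 * L)) - q) * (Lag xnext yt - D yt) := by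
  have hn : (0 : ℝ) < n := by exact_mod_cast lt_of_lt_of_le hk1 hkn
  have hk : (0 : ℝ) < k := by exact_mod_cast hk1
  have hL : 0 < L := hμ.trans_le hμL
  have hR0 : 0 ≤ R := (sq_nonneg _).trans (hR ⟨0, lt_of_lt_of_le hk1 hkn⟩)
  have hq0 : 0 ≤ q := by rw [hqdef]; positivity
  set w : Fin n → ℝ := fun i => (1 / n : ℝ) * ⟪a i, xt⟫ - φ' yt i with hw
  set e : Fin n → ℝ := fun i => (1 / n : ℝ) * ⟪a i, xbar - xt⟫ with he
  set b : EuclideanSpace ℝ (Fin d) := (n : ℝ)⁻¹ • ∑ i, yt i • a i with hb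
  have hbx : ∀ x, (1 / n : ℝ) * (∑ i, yt i * ⟪a i, x⟫) = ⟪b, x⟫ := by
    intro x
    simp [hb, inner_smul_left, sum_inner]
  have hLagt : ∀ x, Lag x yt = g x + ⟪b, x⟫ - φ yt := fun x => by rw [hLag, hbx]
  have hDw : ∀ i, D' yt i = w i + e i := by
    intro i
    simp only [hgradD, hw, he, inner_sub_right]
    ring
  -- primal side
  have hsm : ∀ u v, Lag v yt ≤ Lag u yt + ⟪g' u + b, v - u⟫ + L / 2 * ‖v - u‖ ^ 2 := by
    intro u v
    rw [hLagt, hLagt, inner_add_left, inner_sub_right b]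
    linarith [hgsm u v]
  have hsc : ∀ u v, Lag u yt + ⟪g' u + b, v - u⟫ + μ / 2 * ‖v - u‖ ^ 2 ≤ Lag v yt := by
    intro u v
    rw [hLagt, hLagt, inner_add_left, inner_sub_right b]
    linarith [hgsc u v]
  have hmin : IsMinOn (fun x => Lag x yt) C xbar := by
    rw [isMinOn_iff]
    intro x hx
    rw [← hxbarD]
    exact (hD yt).2 ⟨x, hx, rfl⟩
  have hdist : μ / 2 * ‖xbar - xt‖ ^ 2 ≤ Lag xt yt - D yt := by
    have := inner_nonneg_of_isMinOn_of_le_quadratic hCconv hxbarC hmin (hsm xbar) hxtC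
    have h2 := hsc xbar xt
    rw [norm_sub_rev, hxbarD]
    linarith
  have hprimal : Lag xnext yt - D yt ≤ (1 - μ / (2 * L)) * (Lag xt yt - D yt) := by
    have hη0 : 0 < η := by rw [hη]; positivity
    have hLη : L * η = μ / 2 := by rw [hη]; field_simp
    have hstep : xnext - xt = η • (xtil - xt) := by rw [hxnext]; module
    have h1 := hsm xt xnext
    rw [hstep, inner_smul_right, norm_smul, Real.norm_eq_abs, mul_pow, sq_abs,
      inner_sub_right] at h1
    have h2 := hsc xt xbar
    rw [inner_sub_right] at h2
    rw [hLη] at hfw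
    have h3 : L / 2 * (η ^ 2 * ‖xtil - xt‖ ^ 2) = η * (μ / 2 / 2 * ‖xtil - xt‖ ^ 2) := by
      rw [← hLη]; ring
    have h4 : η * (⟪g' xt + b, xtil⟫ - ⟪g' xt + b, xt⟫ + μ / 2 / 2 * ‖xtil - xt‖ ^ 2)
        ≤ η * (D yt - Lag xt yt) := by
      refine mul_le_mul_of_nonneg_left ?_ hη0.le
      rw [hxbarD]
      have : 0 ≤ μ * ‖xbar - xt‖ ^ 2 := by positivity
      linarith
    rw [← hη]
    linarith
  -- dual side
  have hdiff : ∀ i, yprev i - yt i = if i ∈ I then -(δ * w i) else 0 := by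
    intro i
    split_ifs with hi
    · rw [hin i hi]; ring
    · rw [hout i hi]; ring
  have hinner : ∀ v : EuclideanSpace ℝ (Fin n),
      ⟪v, yprev - yt⟫ = -(δ * ∑ i ∈ I, v i * w i) := by
    intro v
    rw [PiLp.inner_apply, Finset.mul_sum, ← Finset.sum_neg_distrib]
    simp [hdiff]
    refine Finset.sum_congr rfl fun i _ => by ring
  have hnormsq : ‖yprev - yt‖ ^ 2 = δ ^ 2 * ∑ i ∈ I, w i ^ 2 := by
    rw [EuclideanSpace.real_norm_sq_eq, Finset.mul_sum]
    simp [hdiff, ite_pow, mul_pow]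
  have hφstep := le_quadratic_of_gradient_lipschitz hφdiff hφlip yt yprev
  have hDstep := hDsc yt yprev
  rw [inner_neg_left] at hDstep
  rw [hinner, hnormsq] at hφstep hDstep
  have hlin : (1 / n : ℝ) * (∑ i, yprev i * ⟪a i, xt⟫)
      = ⟪b, xt⟫ - δ * ∑ i ∈ I, (1 / n : ℝ) * ⟪a i, xt⟫ * w i := by
    have h := hinner (WithLp.toLp 2 fun i => (1 / n : ℝ) * ⟪a i, xt⟫)
    rw [PiLp.inner_apply] at h
    simp only [PiLp.sub_apply] at h
    rw [sub_eq_add_neg, ← h, ← hbx, Finset.mul_sum, Finset.mul_sum, ← Finset.sum_add_distrib]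
    refine Finset.sum_congr rfl fun i _ => ?_
    simp
    ring
  have hascent : Lag xt yt - Lag xt yprev
      ≤ δ * ∑ i ∈ I, w i ^ 2 + (1 / α) / 2 * (δ ^ 2 * ∑ i ∈ I, w i ^ 2) := by
    have hsplit : ∑ i ∈ I, w i ^ 2
        = ∑ i ∈ I, (1 / n : ℝ) * ⟪a i, xt⟫ * w i - ∑ i ∈ I, φ' yt i * w i := by
      rw [← Finset.sum_sub_distrib]
      exact Finset.sum_congr rfl fun i _ => by simp only [hw]; ring
    rw [hLagt, hLag xt yprev, hlin]
    have h2 : δ * ∑ i ∈ I, w i ^ 2 = δ * ∑ i ∈ I, (1 / n : ℝ) * ⟪a i, xt⟫ * w i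
        - δ * ∑ i ∈ I, φ' yt i * w i := by rw [hsplit]; ring
    linarith
  have hdual : β / α * (D yprev - D yt) ≤
      -(β / α * (δ * ∑ i ∈ I, (w i + e i) * w i)) - (1 / α) / 2 * (δ ^ 2 * ∑ i ∈ I, w i ^ 2) := by
    simp only [hDw] at hDstep
    have h := mul_le_mul_of_nonneg_left
      (show D yprev - D yt ≤ -(δ * ∑ i ∈ I, (w i + e i) * w i)
        - (1 / β) / 2 * (δ ^ 2 * ∑ i ∈ I, w i ^ 2) by linarith) (div_pos hβ hα).le
    refine h.trans (le_of_eq ?_)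
    field_simp
  have hcoord : δ * ∑ i ∈ I, w i ^ 2 - β / α * (δ * ∑ i ∈ I, (w i + e i) * w i) ≤
      -(β * δ / (4 * α)) * ∑ i ∈ I, w i ^ 2 + β * δ / α * ∑ i ∈ I, e i ^ 2 := by
    simp only [Finset.mul_sum, ← Finset.sum_sub_distrib, ← Finset.sum_add_distrib]
    exact Finset.sum_le_sum fun i _ => dual_progress_pointwise hα hδ hαβ
  have he_le : ∀ i, e i ^ 2 ≤ R * ‖xbar - xt‖ ^ 2 / n ^ 2 := by
    intro i
    have hcs : ⟪a i, xbar - xt⟫ ^ 2 ≤ ‖a i‖ ^ 2 * ‖xbar - xt‖ ^ 2 := by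
      rw [← mul_pow]
      exact sq_le_sq.2 ((abs_real_inner_le_norm _ _).trans (le_abs_self _))
    have h2 := hcs.trans (mul_le_mul_of_nonneg_right (hR i) (sq_nonneg _))
    rw [le_div_iff₀ (by positivity)]
    refine le_trans (le_of_eq ?_) h2
    simp only [he]
    field_simp
  have heI : ∑ i ∈ I, e i ^ 2 ≤ k * (R * ‖xbar - xt‖ ^ 2 / n ^ 2) := by
    simpa [hI] using Finset.sum_le_card_nsmul I _ _ fun i _ => he_le i
  have heU : ∑ i, e i ^ 2 ≤ n * (R * ‖xbar - xt‖ ^ 2 / n ^ 2) := by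
    simpa using Finset.sum_le_card_nsmul Finset.univ _ _ fun i _ => he_le i
  have htop : (k : ℝ) * ∑ i, w i ^ 2 ≤ n * ∑ i ∈ I, w i ^ 2 := by
    simpa [hI] using card_mul_sum_le_of_forall_sum_le (f := fun i => w i ^ 2) (I := I)
      (fun J hJ => hgreedy J (hJ.trans hI))
  have hwU : 1 / 2 * ‖D' yt‖ ^ 2 ≤ ∑ i, w i ^ 2 + ∑ i, e i ^ 2 := by
    rw [EuclideanSpace.real_norm_sq_eq, Finset.mul_sum, ← Finset.sum_add_distrib]
    refine Finset.sum_le_sum fun i _ => ?_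
    rw [hDw]
    nlinarith [sq_nonneg (w i - e i)]
  have hPL : Dstar - D yt ≤ β / 2 * ‖D' yt‖ ^ 2 := by
    obtain ⟨ys, hys⟩ := hDatt
    rw [← hys]
    exact sub_le_of_strongly_concave hβ (hDsc yt ys)
  have hgap : k * δ / (4 * α * n) * (Dstar - D yt) ≤
      β * δ / (4 * α) * ∑ i ∈ I, w i ^ 2 + β * δ * k / (4 * α * n) * ∑ i, e i ^ 2 := by
    calc k * δ / (4 * α * n) * (Dstar - D yt)
        ≤ k * δ / (4 * α * n) * (β * (∑ i, w i ^ 2 + ∑ i, e i ^ 2)) := by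
          refine mul_le_mul_of_nonneg_left ?_ (by positivity)
          have := mul_le_mul_of_nonneg_left hwU hβ.le
          linarith
      _ = β * δ / (4 * α * n) * (k * ∑ i, w i ^ 2)
            + β * δ * k / (4 * α * n) * ∑ i, e i ^ 2 := by ring
      _ ≤ β * δ / (4 * α * n) * (n * ∑ i ∈ I, w i ^ 2)
            + β * δ * k / (4 * α * n) * ∑ i, e i ^ 2 := by gcongr
      _ = _ := by field_simp
  have herr : β * δ / α * ∑ i ∈ I, e i ^ 2 + β * δ * k / (4 * α * n) * ∑ i, e i ^ 2
      ≤ q * (Lag xt yt - D yt) := by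
    calc _ ≤ β * δ / α * (k * (R * ‖xbar - xt‖ ^ 2 / n ^ 2))
            + β * δ * k / (4 * α * n) * (n * (R * ‖xbar - xt‖ ^ 2 / n ^ 2)) := by gcongr
      _ = q * (μ / 2 * ‖xbar - xt‖ ^ 2) := by
          rw [hqdef]
          field_simp
          ring
      _ ≤ _ := mul_le_mul_of_nonneg_left hdist hq0
  -- combination
  have hP0 : 0 ≤ Lag xt yt - D yt := le_trans (by positivity) hdist
  have hfinal : (1 - q) * ((1 + μ / (4 * L)) * (Lag xnext yt - D yt))
      ≤ (1 - q) * (Lag xt yt - D yt) := by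
    refine mul_le_mul_of_nonneg_left ?_ (sub_nonneg.2 hq)
    refine one_add_mul_le_of_le_one_sub_two_mul (by positivity) hP0 ?_
    rwa [show 2 * (μ / (4 * L)) = μ / (2 * L) by ring]
  linarith
end

section
/- Let C ⊆ ℝ^d be a nonempty compact convex set, let g : ℝ^d → ℝ be convex and continuous, let f_1,…,f_n : ℝ → ℝ be convex, and let A be a real n×d matrix with rows a_1,…,a_n. Then min_{x∈C} [(1/n)Σ_{i=1}^n f_i(⟨a_i, x⟩) + g(x)] = sup_{y∈ℝ^n} inf_{x∈C} [g(x) + (1/n)⟨y, A x⟩ − (1/n)Σ_{i=1}^n f_i*(y_i)], where for y such that f_i*(y_i) = +∞ for some i, the inner expression is interpreted as −∞. -/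
open RealInnerProductSpace

/-- A uniform bound on separable sums bounds the sum of the coordinatewise suprema. -/
theorem sum_le_of_isLUB_of_forall_sum_le {ι T : Type*} [Fintype ι] {φ : ι → T → ℝ} {S : ι → ℝ}
    {K : ℝ} (hS : ∀ i, IsLUB (Set.range (φ i)) (S i)) (hK : ∀ t : ι → T, ∑ i, φ i (t i) ≤ K) :
    ∑ i, S i ≤ K := by
  have key : ∀ ε > 0, ∑ i, S i ≤ K + Fintype.card ι * ε := by
    intro ε hε
    have hex : ∀ i, ∃ t, S i - ε < φ i t := by
      intro i
      obtain ⟨_, ⟨t, rfl⟩, ht, -⟩ := (hS i).exists_between (sub_lt_self (S i) hε)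
      exact ⟨t, ht⟩
    choose t ht using hex
    have h := Finset.sum_le_sum fun i (_ : i ∈ Finset.univ) => (ht i).le
    rw [Finset.sum_sub_distrib] at h
    simp only [Finset.sum_const, Finset.card_univ, nsmul_eq_mul] at h
    linarith [hK t]
  refine le_of_forall_pos_le_add fun ε hε => ?_
  refine (key (ε / (Fintype.card ι + 1)) (by positivity)).trans ?_
  gcongr
  rw [mul_div_assoc', div_le_iff₀ (by positivity)]
  nlinarith

/-- Existence of a Fenchel dual certificate: a lower bound of `g x + ∑ i, F i (L i x)` on a convex
set is preserved, up to a linear term, under decoupling `L i x` from the argument of `F i`. -/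
theorem exists_dual_certificate {E ι : Type*} [AddCommGroup E] [Module ℝ E] [Fintype ι]
    {C : Set E} (hCne : C.Nonempty) (hC : Convex ℝ C) {g : E → ℝ} (hg : ConvexOn ℝ C g)
    {F : ι → ℝ → ℝ} (hF : ∀ i, ConvexOn ℝ Set.univ (F i)) (L : ι → E →ₗ[ℝ] ℝ) {m : ℝ}
    (hm : ∀ x ∈ C, m ≤ g x + ∑ i, F i (L i x)) :
    ∃ p : ι → ℝ, ∀ x ∈ C, ∀ t : ι → ℝ,
      m ≤ g x + ∑ i, p i * L i x - ∑ i, (p i * t i - F i (t i)) := by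
  classical
  have hFc : ∀ i, Continuous (F i) := fun i =>
    continuousOn_univ.1 ((hF i).continuousOn isOpen_univ)
  let S : Set ((ι → ℝ) × ℝ) := {q | ∃ x ∈ C, g x + ∑ i, F i (L i x + q.1 i) < q.2}
  have hSo : IsOpen S := by
    have : S = ⋃ x ∈ C, {q : (ι → ℝ) × ℝ | g x + ∑ i, F i (L i x + q.1 i) < q.2} := by
      ext q; simp [S]
    rw [this]
    refine isOpen_biUnion fun x _ => isOpen_lt ?_ continuous_snd
    refine continuous_const.add (continuous_finsetSum _ fun i _ => (hFc i).comp ?_)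
    fun_prop
  have hSc : Convex ℝ S := by
    rintro ⟨u, r⟩ ⟨x, hx, hxr⟩ ⟨v, s⟩ ⟨z, hz, hzs⟩ α β hα hβ hαβ
    refine ⟨α • x + β • z, hC hx hz hα hβ hαβ, ?_⟩
    have h1 := hg.2 hx hz hα hβ hαβ
    have h2 : ∑ i, F i (L i (α • x + β • z) + (α • u + β • v) i) ≤
        α * ∑ i, F i (L i x + u i) + β * ∑ i, F i (L i z + v i) := by
      rw [Finset.mul_sum, Finset.mul_sum, ← Finset.sum_add_distrib]
      refine Finset.sum_le_sum fun i _ => ?_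
      have := (hF i).2 (Set.mem_univ (L i x + u i)) (Set.mem_univ (L i z + v i)) hα hβ hαβ
      simp only [smul_eq_mul] at this
      convert this using 2
      simp only [map_add, map_smul, smul_eq_mul, Pi.add_apply, Pi.smul_apply]
      ring
    simp only [smul_eq_mul] at h1
    change _ + ∑ i, F i (_ + (α • u + β • v) i) < α * r + β * s
    simp only at hxr hzs
    rcases hα.eq_or_lt with rfl | hα'
    · have : β = 1 := by linarith
      subst this
      linarith
    · have := mul_lt_mul_of_pos_left hxr hα'
      have := mul_le_mul_of_nonneg_left hzs.le hβ
      linarith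
  have h0 : ((0 : ι → ℝ), m) ∉ S := by
    rintro ⟨x, hx, hlt⟩
    simp only [Pi.zero_apply, add_zero] at hlt
    exact hlt.not_ge (hm x hx)
  obtain ⟨ψ, hψ⟩ := geometric_hahn_banach_point_open hSc hSo h0
  have hdec : ∀ (u : ι → ℝ) (r : ℝ),
      ψ (u, r) = ∑ i, u i * ψ (Pi.single i 1, 0) + r * ψ (0, 1) := by
    intro u r
    have hu : (u, r) = ∑ i, u i • ((Pi.single i 1 : ι → ℝ), (0 : ℝ)) + 
        r • ((0 : ι → ℝ), (1 : ℝ)) := by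
      ext j
      · simp [Prod.fst_sum, Finset.sum_apply, Pi.single_apply]
      · simp [Prod.snd_sum]
    rw [hu]
    simp only [map_add, map_sum, map_smul, smul_eq_mul]
  set β := ψ (0, 1) with hβdef
  have hψ' : ∀ x ∈ C, ∀ (u : ι → ℝ) (r : ℝ), g x + ∑ i, F i (L i x + u i) < r →
      m * β < ∑ i, u i * ψ (Pi.single i 1, 0) + r * β := by
    intro x hx u r h
    have := hψ (u, r) ⟨x, hx, h⟩
    rw [hdec, hdec u] at this
    simpa using this
  have hβ : 0 < β := by
    obtain ⟨x, hx⟩ := hCne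
    have h1 := hψ' x hx 0 (g x + ∑ i, F i (L i x) + 1) (by simp)
    simp only [Pi.zero_apply, zero_mul, Finset.sum_const_zero, zero_add] at h1
    nlinarith [hm x hx]
  refine ⟨fun i => -(ψ (Pi.single i 1, 0) / β), fun x hx t => ?_⟩
  refine le_of_forall_pos_le_add fun ε hε => ?_
  have h1 := hψ' x hx (fun i => t i - L i x) (g x + ∑ i, F i (t i) + ε) (by simpa using hε)
  have h2 : m < (∑ i, (t i - L i x) * ψ (Pi.single i 1, 0)) / β + (g x + ∑ i, F i (t i) + ε) := by
    rw [← mul_lt_mul_iff_left₀ hβ, add_mul, div_mul_cancel₀ _ hβ.ne']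
    exact h1
  refine h2.le.trans (le_of_eq ?_)
  have h3 : (∑ i, (t i - L i x) * ψ (Pi.single i 1, 0)) / β =
      ∑ i, -(ψ (Pi.single i 1, 0) / β) * L i x - ∑ i, -(ψ (Pi.single i 1, 0) / β) * t i := by
    rw [← Finset.sum_sub_distrib, Finset.sum_div]
    exact Finset.sum_congr rfl fun i _ => by ring
  rw [h3, Finset.sum_sub_distrib]
  ring

theorem EReal.coe_sum_real {ι : Type*} (s : Finset ι) (φ : ι → ℝ) :
    ((∑ i ∈ s, φ i : ℝ) : EReal) = ∑ i ∈ s, (φ i : EReal) := by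
  classical
  induction s using Finset.induction_on with
  | empty => simp
  | insert i s hi ih => rw [Finset.sum_insert hi, Finset.sum_insert hi, EReal.coe_add, ih]

theorem stmt_14 {n d : ℕ} (C : Set (EuclideanSpace ℝ (Fin d)))
    (hCne : C.Nonempty) (hCcomp : IsCompact C) (hCconv : Convex ℝ C)
    (g : EuclideanSpace ℝ (Fin d) → ℝ)
    (hgconv : ConvexOn ℝ Set.univ g) (hgcont : Continuous g)
    (f : Fin n → ℝ → ℝ) (hfconv : ∀ i, ConvexOn ℝ Set.univ (f i))
    (a : Fin n → EuclideanSpace ℝ (Fin d))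
    (fconj : Fin n → ℝ → EReal)
    (hfconj : ∀ i z, fconj i z = ⨆ t : ℝ, ((z * t - f i t : ℝ) : EReal)) :
    (⨅ x ∈ C, (((1 / n : ℝ) * ∑ i, f i ⟪a i, x⟫ + g x : ℝ) : EReal)) =
      ⨆ y : EuclideanSpace ℝ (Fin n), ⨅ x ∈ C,
        (((g x + (1 / n : ℝ) * ∑ i, y i * ⟪a i, x⟫ : ℝ) : EReal)
          - ((1 / n : ℝ) : EReal) * ∑ i, fconj i (y i)) := by
  have hc : (0 : ℝ) ≤ 1 / n := by positivity
  have hcpos : Fin n → (0 : ℝ) < 1 / n := fun i => by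
    have : 0 < n := i.pos
    positivity
  generalize (1 / n : ℝ) = c at hc hcpos ⊢
  apply le_antisymm
  · have hcont : Continuous fun x => c * ∑ i, f i ⟪a i, x⟫ + g x := by
      have hfc : ∀ i, Continuous (f i) := fun i =>
        continuousOn_univ.1 ((hfconv i).continuousOn isOpen_univ)
      refine (continuous_const.mul (continuous_finsetSum _ fun i _ => (hfc i).comp ?_)).add hgcont
      fun_prop
    obtain ⟨x₀, hx₀, hmin⟩ := hCcomp.exists_isMinOn hCne hcont.continuousOn
    obtain ⟨p, hp⟩ := exists_dual_certificate hCne hCconv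
      (hgconv.subset (Set.subset_univ _) hCconv) (F := fun i s => c * f i s)
      (fun i => (hfconv i).smul hc) (fun i => (innerSL ℝ (a i)).toLinearMap)
      (m := c * ∑ i, f i ⟪a i, x₀⟫ + g x₀) (fun x hx => by
        have := hmin hx
        simp only [Set.mem_ofPred_eq] at this
        simpa [← Finset.mul_sum, add_comm] using this)
    set m := c * ∑ i, f i ⟪a i, x₀⟫ + g x₀
    let y : Fin n → ℝ := fun i => p i / c
    have hpy : ∀ i, p i = c * y i := fun i => by
      have := (hcpos i).ne'
      simp only [y]
      field_simp
    have hy : ∀ x ∈ C, ∀ t : Fin n → ℝ,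
        c * ∑ i, (y i * t i - f i (t i)) ≤ g x + c * ∑ i, y i * ⟪a i, x⟫ - m := by
      intro x hx t
      have := hp x hx t
      simp only [hpy, mul_assoc, ← mul_sub, ← Finset.mul_sum] at this
      simp only [ContinuousLinearMap.coe_coe, innerSL_apply_apply] at this
      linarith
    have hbdd : ∀ i, BddAbove (Set.range fun t => y i * t - f i t) := by
      intro i
      refine ⟨(g x₀ + c * ∑ i, y i * ⟪a i, x₀⟫ - m) / c
        - ∑ j ∈ Finset.univ.erase i, (y j * 0 - f j 0), ?_⟩
      rintro _ ⟨s, rfl⟩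
      have h1 := hy x₀ hx₀ (Function.update 0 i s)
      rw [mul_comm, ← le_div_iff₀ (hcpos i), ← Finset.add_sum_erase _ _ (Finset.mem_univ i),
        Function.update_self, Finset.sum_congr rfl (g := fun j => y j * 0 - f j 0)
          (fun j hj => by
            rw [Function.update_of_ne (Finset.ne_of_mem_erase hj), Pi.zero_apply])] at h1
      dsimp only
      linarith
    have hlub := fun i => isLUB_ciSup (hbdd i)
    have hconj : ∀ i, fconj i (y i) ≤ ((⨆ t, (y i * t - f i t) : ℝ) : EReal) := fun i => by
      rw [hfconj]
      exact iSup_le fun t => EReal.coe_le_coe_iff.2 ((hlub i).1 ⟨t, rfl⟩)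
    refine (iInf₂_le x₀ hx₀).trans (le_iSup_of_le (WithLp.toLp 2 y) (le_iInf₂ fun x hx => ?_))
    have hreal : c * ∑ i, (⨆ t, (y i * t - f i t)) ≤ g x + c * ∑ i, y i * ⟪a i, x⟫ - m := by
      rcases hc.eq_or_lt with h | h
      · simpa [← h] using hy x hx 0
      · rw [mul_comm, ← le_div_iff₀ h]
        refine sum_le_of_isLUB_of_forall_sum_le hlub fun t => ?_
        rw [le_div_iff₀ h, mul_comm]
        exact hy x hx t
    calc (m : EReal) ≤ ((g x + c * ∑ i, y i * ⟪a i, x⟫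
          - c * ∑ i, (⨆ t, (y i * t - f i t)) : ℝ) : EReal) :=
          EReal.coe_le_coe_iff.2 (by linarith)
      _ ≤ _ := by
        rw [EReal.coe_sub, EReal.coe_mul, EReal.coe_sum_real]
        refine EReal.sub_le_sub le_rfl (mul_le_mul_of_nonneg_left ?_ (EReal.coe_nonneg.2 hc))
        exact Finset.sum_le_sum fun i _ => hconj i
  · refine iSup_le fun y => iInf₂_mono fun x _ => ?_
    calc _ ≤ ((g x + c * ∑ i, y i * ⟪a i, x⟫ : ℝ) : EReal)
          - (c : EReal) * ∑ i, ((y i * ⟪a i, x⟫ - f i ⟪a i, x⟫ : ℝ) : EReal) := by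
          refine EReal.sub_le_sub le_rfl (mul_le_mul_of_nonneg_left ?_ (EReal.coe_nonneg.2 hc))
          refine Finset.sum_le_sum fun i _ => ?_
          rw [hfconj]
          exact le_iSup (fun t : ℝ => ((y i * t - f i t : ℝ) : EReal)) ⟪a i, x⟫
      _ = _ := by
          rw [← EReal.coe_sum_real, ← EReal.coe_mul, ← EReal.coe_sub, Finset.sum_sub_distrib]
          congr 1
          ring
end
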